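/- arXiv:1401.4415 — 2 statements merged into one kernel-verified Lean document; each statement's English description precedes it below -/
import Mathlib

section
/- For every t ∈ (0,1], the domain of the t-Aluthge transform satisfies D(Δ_t(S_λ)) = D(S_μ) ∩ D(M_{1−t}), where S_μ is the weighted shift with the weights μ, and moreover Δ_t(S_λ) f = S_μ f for every f ∈ D(Δ_t(S_λ)). -/
open scoped ENNReal NNReal ComplexConjugate Classical ComplexInnerProductSpace

noncomputable section

/-- `HS V` is the Hilbert space `ℓ²(V)` of square-summable families of complex numbers
indexed by `V`. -/
abbrev HS (V : Type*) : Type _ := lp (fun _ : V => ℂ) 2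

/-- A (possibly unbounded) partially defined operator in a Hilbert space `E`: a domain
together with an assignment of values.  Only the restriction of `toFun` to `dom` is
relevant (e.g. via `POp.graph`). -/
structure POp (E : Type*) [NormedAddCommGroup E] [InnerProductSpace ℂ E] where
  dom : Set E
  toFun : E → E

namespace POp

variable {E : Type*} [NormedAddCommGroup E] [InnerProductSpace ℂ E]

/-- Composition of partially defined operators: `(A.comp B) f = A (B f)` on the natural
domain `{f ∈ dom B : B f ∈ dom A}`. -/
def comp (A B : POp E) : POp E :=
  ⟨{f | f ∈ B.dom ∧ B.toFun f ∈ A.dom}, fun f => A.toFun (B.toFun f)⟩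

/-- The graph of a partially defined operator, as a subset of `E × E`. -/
def graph (A : POp E) : Set (E × E) := {p | p.1 ∈ A.dom ∧ p.2 = A.toFun p.1}

/-- The Hilbert-space adjoint of a (densely defined) partially defined operator `A`:
`g ∈ dom A*` iff there is `h` with `⟪A f, g⟫ = ⟪f, h⟫` for all `f ∈ dom A`, and then
`A* g = h` (`h` is unique when `A` is densely defined). -/
def adj (A : POp E) : POp E :=
  ⟨{g | ∃ h : E, ∀ f ∈ A.dom, ⟪A.toFun f, g⟫ = ⟪f, h⟫},
   fun g => if h : ∃ h' : E, ∀ f ∈ A.dom, ⟪A.toFun f, g⟫ = ⟪f, h'⟫ then h.choose else 0⟩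

end POp

variable {V : Type*}

/-- The element of `ℓ²(V)` with coordinates `g` (junk value `0` if `g` is not
square-summable). -/
def mkH (g : V → ℂ) : HS V := if h : Memℓp g 2 then ⟨g, h⟩ else 0

/-- The standard orthonormal basis vector `e_u` of `ℓ²(V)`. -/
def eV (u : V) : HS V := mkH (fun v => if v = u then 1 else 0)

/-- The weighted shift `S_λ` on the directed tree encoded by the parent map `par`
(with `Chi(u) = {v : par v = u}`), with weights `lam`:
domain `{f : Σ_u (Σ_{v ∈ Chi(u)} |λ v|²)·|f u|² < ∞}` and value
`(S_λ f)(v) = λ v · f (par v)`. -/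
def shiftOp (par : V → V) (lam : V → ℂ) : POp (HS V) :=
  ⟨{f | ∑' u : V, ((∑' v : {v : V // par v = u}, ((‖lam v.1‖₊ : ℝ≥0∞) ^ 2)) *
        (‖f u‖₊ : ℝ≥0∞) ^ 2) < ⊤},
   fun f => mkH (fun v => lam v * f (par v))⟩

/-- `cW par lam u = (Σ_{v ∈ Chi(u)} |λ v|²)^{1/2}`, i.e. `c(u) = ‖S_λ e_u‖`. -/
def cW (par : V → V) (lam : V → ℂ) (u : V) : ℝ :=
  Real.sqrt (∑' v : {v : V // par v = u}, ‖lam v.1‖ ^ 2)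

/-- The multiplication operator `M_α` (representing `|S_λ|^α`): domain
`{f : Σ_u c(u)^{2α}·|f u|² < ∞}` and `(M_α f)(u) = c(u)^α·f(u)`. -/
def mulOp (par : V → V) (lam : V → ℂ) (α : ℝ) : POp (HS V) :=
  ⟨{f | Summable fun u : V => cW par lam u ^ (2 * α) * ‖f u‖ ^ 2},
   fun f => mkH (fun u => ((cW par lam u ^ α : ℝ) : ℂ) * f u)⟩

/-- The weights `π` of the partial isometry in the polar decomposition of `S_λ`:
`π v = λ v / c(par v)` if `c(par v) > 0`, and `π v = 0` otherwise. -/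
def piW (par : V → V) (lam : V → ℂ) (v : V) : ℂ :=
  if 0 < cW par lam (par v) then lam v / ((cW par lam (par v) : ℝ) : ℂ) else 0

/-- The partial isometry `S_π` of the polar decomposition of `S_λ`
(a contraction defined on all of `ℓ²(V)`). -/
def piOp (par : V → V) (lam : V → ℂ) : POp (HS V) :=
  ⟨Set.univ, fun f => mkH (fun v => piW par lam v * f (par v))⟩

/-- The weights `μ`: `μ v = (c v / c (par v))^t · λ v` if `c (par v) > 0`, else `0`. -/
def muW (par : V → V) (lam : V → ℂ) (t : ℝ) (v : V) : ℂ :=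
  if 0 < cW par lam (par v)
  then (((cW par lam v / cW par lam (par v)) ^ t : ℝ) : ℂ) * lam v else 0

/-- The `t`-Aluthge transform `Δ_t(S_λ) = M_t ∘ S_π ∘ M_{1-t} = |S_λ|^t S_π |S_λ|^{1-t}`. -/
def aluthge (par : V → V) (lam : V → ℂ) (t : ℝ) : POp (HS V) :=
  ((mulOp par lam t).comp (piOp par lam)).comp (mulOp par lam (1 - t))

theorem memlp_two_iff_summable {V : Type*} (g : V → ℂ) :
    Memℓp g 2 ↔ Summable fun v => ‖g v‖ ^ 2 := by
  rw [memℓp_gen_iff (by norm_num)]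
  simp

theorem mkH_apply {V : Type*} {g : V → ℂ} (hg : Memℓp g 2) (v : V) : mkH g v = g v := by
  simp [mkH, hg]

theorem summable_norm_sq_iff_tsum_lt_top {V : Type*} (g : V → ℂ) :
    (Summable fun v => ‖g v‖ ^ 2) ↔ ∑' v, (‖g v‖₊ : ℝ≥0∞) ^ 2 < ⊤ := by
  rw [lt_top_iff_ne_top]
  have h := ENNReal.tsum_coe_ne_top_iff_summable (f := fun v => ‖g v‖₊ ^ 2)
  push_cast at h
  rw [h, ← NNReal.summable_coe]
  simp

theorem mem_shiftOp_dom_iff {V : Type*} (par : V → V) (lam : V → ℂ) (f : HS V) :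
    f ∈ (shiftOp par lam).dom ↔ Summable fun v => ‖lam v * f (par v)‖ ^ 2 := by
  rw [summable_norm_sq_iff_tsum_lt_top, ← (Equiv.sigmaFiberEquiv par).tsum_eq,
    ENNReal.tsum_sigma']
  have key : ∀ u, (∑' v : {v : V // par v = u}, ((‖lam v.1‖₊ : ℝ≥0∞) ^ 2)) *
      (‖f u‖₊ : ℝ≥0∞) ^ 2 = ∑' v : {v : V // par v = u},
        (‖lam v.1 * f (par v.1)‖₊ : ℝ≥0∞) ^ 2 := by
    intro u
    rw [← ENNReal.tsum_mul_right]
    refine tsum_congr fun v => ?_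
    rw [v.2, nnnorm_mul, ENNReal.coe_mul, mul_pow]
  simp only [shiftOp, Set.mem_ofPred_eq, key]
  rfl

theorem cW_nonneg {V : Type*} (par : V → V) (lam : V → ℂ) (u : V) : 0 ≤ cW par lam u :=
  Real.sqrt_nonneg _

theorem mem_mulOp_dom_iff {V : Type*} (par : V → V) (lam : V → ℂ) (α : ℝ) (f : HS V) :
    f ∈ (mulOp par lam α).dom ↔
      Summable fun u => ‖((cW par lam u ^ α : ℝ) : ℂ) * f u‖ ^ 2 := by
  refine iff_of_eq (congrArg Summable (funext fun u => ?_))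
  have h := cW_nonneg par lam u
  rw [norm_mul, mul_pow, Complex.norm_real, Real.norm_eq_abs, sq_abs, mul_comm 2 α,
    Real.rpow_mul h, Real.rpow_two]

theorem tsum_piW_le_one {V : Type*} (par : V → V) (lam : V → ℂ)
    (hl : ∀ u : V, Summable fun v : {v : V // par v = u} => ‖lam v.1‖ ^ 2) (u : V) :
    ∑' v : {v : V // par v = u}, ((‖piW par lam v.1‖₊ : ℝ≥0∞) ^ 2) ≤ 1 := by
  by_cases hc : 0 < cW par lam u
  · have hterm : ∀ v : {v : V // par v = u}, ((‖piW par lam v.1‖₊ : ℝ≥0∞) ^ 2) =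
        ENNReal.ofReal (‖lam v.1‖ ^ 2 / cW par lam u ^ 2) := by
      intro v
      have hv : piW par lam v.1 = lam v.1 / ((cW par lam u : ℝ) : ℂ) := by
        simp [piW, v.2, hc]
      rw [hv, ← enorm_eq_nnnorm, ← ofReal_norm, ← ENNReal.ofReal_pow (norm_nonneg _),
        norm_div, Complex.norm_real, Real.norm_of_nonneg hc.le, div_pow]
    simp_rw [hterm]
    rw [← ENNReal.ofReal_tsum_of_nonneg (fun v => by positivity) ((hl u).div_const _),
      tsum_div_const, ENNReal.ofReal_le_one]
    have hsq : cW par lam u ^ 2 = ∑' v : {v : V // par v = u}, ‖lam v.1‖ ^ 2 :=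
      Real.sq_sqrt (tsum_nonneg fun _ => by positivity)
    rw [← hsq, div_self (by positivity)]
  · have hterm : ∀ v : {v : V // par v = u}, piW par lam v.1 = 0 := by
      intro v
      simp [piW, v.2, hc]
    simp [hterm]

theorem memlp_piW_mul {V : Type*} (par : V → V) (lam : V → ℂ)
    (hl : ∀ u : V, Summable fun v : {v : V // par v = u} => ‖lam v.1‖ ^ 2) (f : HS V) :
    Memℓp (fun v => piW par lam v * f (par v)) 2 := by
  rw [memlp_two_iff_summable, ← mem_shiftOp_dom_iff]
  have hf := (summable_norm_sq_iff_tsum_lt_top f).1 ((memlp_two_iff_summable f).1 (lp.memℓp f))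
  refine lt_of_le_of_lt (ENNReal.tsum_le_tsum fun u => ?_) hf
  exact (mul_le_mul_left (tsum_piW_le_one par lam hl u) _).trans (one_mul _).le

theorem cW_rpow_mul_piW_mul {V : Type*} (par : V → V) (lam : V → ℂ) (t : ℝ) (v : V) (z : ℂ) :
    ((cW par lam v ^ t : ℝ) : ℂ) *
      (piW par lam v * (((cW par lam (par v) ^ (1 - t) : ℝ) : ℂ) * z)) =
      muW par lam t v * z := by
  by_cases hc : 0 < cW par lam (par v)
  · have hne : ((cW par lam (par v) : ℝ) : ℂ) ≠ 0 := by exact_mod_cast hc.ne'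
    have hne' : ((cW par lam (par v) ^ t : ℝ) : ℂ) ≠ 0 := by
      exact_mod_cast (Real.rpow_pos_of_pos hc t).ne'
    rw [piW, muW, if_pos hc, if_pos hc, Real.div_rpow (cW_nonneg _ _ _) hc.le,
      Real.rpow_sub hc, Real.rpow_one]
    push_cast
    field_simp
  · simp [piW, muW, hc]

/-- Theorem 4.1 (i): for `t ∈ (0,1]`,
`D(Δ_t(S_λ)) = D(S_μ) ∩ D(M_{1-t})` and `Δ_t(S_λ) f = S_μ f` on `D(Δ_t(S_λ))`. -/
theorem statement_4 (V : Type*) [Nonempty V] (par : V → V)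
    (ha : ∀ u v : V, ∃ m n : ℕ, par^[m] u = par^[n] v)
    (hb : ∀ (v : V) (n : ℕ), 1 ≤ n → par^[n] v ≠ v)
    (lam : V → ℂ)
    (hl : ∀ u : V, Summable fun v : {v : V // par v = u} => ‖lam v.1‖ ^ 2)
    (t : ℝ) (ht : t ∈ Set.Ioc (0 : ℝ) 1) :
    (aluthge par lam t).dom
        = (shiftOp par (muW par lam t)).dom ∩ (mulOp par lam (1 - t)).dom ∧
    ∀ f ∈ (aluthge par lam t).dom,
      (aluthge par lam t).toFun f = (shiftOp par (muW par lam t)).toFun f := by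
  have hM : ∀ f ∈ (mulOp par lam (1 - t)).dom, ∀ v,
      (((cW par lam v ^ t : ℝ) : ℂ) *
        (piOp par lam).toFun ((mulOp par lam (1 - t)).toFun f) v) =
        muW par lam t v * f (par v) := by
    intro f hf v
    have hf' := (memlp_two_iff_summable _).2 ((mem_mulOp_dom_iff par lam (1 - t) f).1 hf)
    have h₁ := mkH_apply (memlp_piW_mul par lam hl ((mulOp par lam (1 - t)).toFun f)) v
    have h₂ := mkH_apply hf' (par v)
    rw [← cW_rpow_mul_piW_mul, ← h₂]
    exact congrArg _ h₁
  have hdom : ∀ f, f ∈ (aluthge par lam t).dom ↔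
      f ∈ (mulOp par lam (1 - t)).dom ∧
        (piOp par lam).toFun ((mulOp par lam (1 - t)).toFun f) ∈ (mulOp par lam t).dom :=
    fun f => ⟨fun h => ⟨h.1, h.2.2⟩, fun h => ⟨h.1, Set.mem_univ _, h.2⟩⟩
  refine ⟨Set.ext fun f => ?_, fun f hf => ?_⟩
  · rw [hdom, Set.mem_inter_iff, and_comm]
    refine and_congr_left fun hf => ?_
    rw [mem_mulOp_dom_iff, mem_shiftOp_dom_iff]
    simp_rw [hM f hf]
  · exact congrArg mkH (funext (hM f hf.1))
end
end

section
/- Suppose λ(v) ≠ 0 for every v ∈ V, S_λ is densely defined, and D(Δ_t(S_λ)) = {0} for some t ∈ (0,1]. Then for every u ∈ V the set Chi(u) of children of u is countably infinite. -/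
open scoped ENNReal NNReal ComplexConjugate Classical ComplexInnerProductSpace

noncomputable section

variable {V : Type*}

/-- `mkH g` vanishes wherever `g` does, whether or not `g` is square-summable. -/
theorem mkH_apply_eq_zero {g : V → ℂ} {v : V} (hg : g v = 0) : mkH g v = 0 := by
  unfold mkH
  split_ifs
  · exact hg
  · rfl

theorem mem_mulOp_dom_of_finite (par : V → V) (lam : V → ℂ) (α : ℝ) {f : HS V} {s : Set V}
    (hs : s.Finite) (hf : ∀ v, v ∉ s → f v = 0) : f ∈ (mulOp par lam α).dom :=
  summable_of_hasFiniteSupport <| hs.subset fun v hv => by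
    by_contra h
    exact hv (by simp [hf v h])

theorem single_mem_aluthge_dom (par : V → V) (lam : V → ℂ) (t : ℝ) {u : V}
    (hu : {v : V | par v = u}.Finite) :
    (lp.single 2 u (1 : ℂ) : HS V) ∈ (aluthge par lam t).dom := by
  have hz : ∀ v, v ≠ u → (lp.single 2 u (1 : ℂ) : HS V) v = 0 := fun v hv => by
    simp [lp.single_apply, hv]
  refine ⟨mem_mulOp_dom_of_finite par lam _ (Set.finite_singleton u) hz, Set.mem_univ _,
    mem_mulOp_dom_of_finite par lam _ hu fun v hv => mkH_apply_eq_zero ?_⟩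
  have h : (mulOp par lam (1 - t)).toFun (lp.single 2 u (1 : ℂ)) (par v) = 0 :=
    mkH_apply_eq_zero (by rw [hz _ hv, mul_zero])
  rw [h, mul_zero]

theorem exists_mem_apply_ne_zero_of_dense {s : Set (HS V)} (hs : Dense s) (u : V) :
    ∃ f ∈ s, f u ≠ 0 := by
  obtain ⟨f, hf, hd⟩ := hs.exists_dist_lt (lp.single 2 u (1 : ℂ) : HS V) one_pos
  refine ⟨f, hf, fun h0 => ?_⟩
  have h := lp.norm_apply_le_norm two_ne_zero ((lp.single 2 u (1 : ℂ) : HS V) - f) u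
  rw [dist_eq_norm] at hd
  rw [lp.coeFn_sub, Pi.sub_apply, h0, lp.single_apply_self, sub_zero, norm_one] at h
  exact absurd hd h.not_gt

theorem countable_children_of_dense (par : V → V) (lam : V → ℂ) (hne : ∀ v, lam v ≠ 0)
    (hdense : Dense (shiftOp par lam).dom) (u : V) : {v : V | par v = u}.Countable := by
  obtain ⟨f, hf, hfu⟩ := exists_mem_apply_ne_zero_of_dense hdense u
  have hlt := (ENNReal.le_tsum u).trans_lt
    (show ∑' u : V, ((∑' v : {v : V // par v = u}, ((‖lam v.1‖₊ : ℝ≥0∞) ^ 2)) *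
        (‖f u‖₊ : ℝ≥0∞) ^ 2) < ⊤ from hf)
  have hfin : ∑' v : {v : V // par v = u}, ((‖lam v.1‖₊ : ℝ≥0∞) ^ 2) ≠ ⊤ := fun htop => by
    rw [htop, ENNReal.top_mul (by simpa using hfu)] at hlt
    exact lt_irrefl _ hlt
  have hcount := Summable.countable_support_ennreal hfin
  rw [show Function.support (fun v : {v : V // par v = u} => (‖lam v.1‖₊ : ℝ≥0∞) ^ 2) =
    Set.univ from Set.eq_univ_of_forall fun v => by simpa using hne v.1] at hcount
  exact Set.countable_coe_iff.mp (Set.countable_univ_iff.mp hcount)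

/-- Proposition 6.8: if all weights are nonzero, `S_λ` is densely
defined and `D(Δ_t(S_λ)) = {0}` for some `t ∈ (0,1]`, then every vertex has countably
infinitely many children. -/
theorem statement_16 (V : Type*) [Nonempty V] (par : V → V)
    (ha : ∀ u v : V, ∃ m n : ℕ, par^[m] u = par^[n] v)
    (hb : ∀ (v : V) (n : ℕ), 1 ≤ n → par^[n] v ≠ v)
    (lam : V → ℂ)
    (hne : ∀ v : V, lam v ≠ 0)
    (hdense : Dense (shiftOp par lam).dom)
    (t : ℝ) (ht : t ∈ Set.Ioc (0 : ℝ) 1)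
    (htriv : (aluthge par lam t).dom = {0}) :
    ∀ u : V, {v : V | par v = u}.Countable ∧ {v : V | par v = u}.Infinite := by
  refine fun u => ⟨countable_children_of_dense par lam hne hdense u, fun hfin => ?_⟩
  have h := single_mem_aluthge_dom par lam t hfin
  rw [htriv, Set.mem_singleton_iff] at h
  have h1 := lp.single_apply_self (E := fun _ : V => ℂ) 2 u 1
  rw [h] at h1
  exact zero_ne_one h1
end
end
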